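/- Let k⃗ = (kₙ)_{n∈ℕ} be an increasing sequence of positive integers, w⃗ = (wₙ)_{n∈ℕ} ∈ L^∞(Σ,k⃗;υ), and Π = {(t,s⃗) : t ∈ L(Σ,k⃗;υ), s⃗ = (sₙ)_{n∈ℕ} ∈ L^∞(Σ,k⃗;υ) with s⃗ ≺ w⃗ and t < sₙ for all n ∈ ℕ}. If a subset R of Π satisfies (i) for every (t,s⃗) ∈ Π there exists (t,s⃗₁) ∈ R with s⃗₁ ≺ s⃗, and (ii) for every (t,s⃗) ∈ R and s⃗₁ ≺ s⃗ one has (t,s⃗₁) ∈ R, then there exists u⃗ ≺ w⃗ such that (t,s⃗) ∈ R for all t ∈ EV(u⃗) and all s⃗ ≺ u⃗ − t, where u⃗ − t = (uₙ)_{n≥l} with l = min{n ∈ ℕ : t < uₙ}. -/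

import Mathlib

namespace Farmaki

/-- A located word over the alphabet `Σ ∪ {υ}`: positions are natural numbers,
`none` means the position is not in the domain, `some 0` is the variable `υ`,
and `some a` for `a ≥ 1` is the letter `αₐ`. -/
abbrev LWord := ℕ → Option ℕ

/-- The domain of a located word. -/
def dom (w : LWord) : Set ℕ := {n | w n ≠ none}

/-- `min dom(w)`. -/
noncomputable def minDom (w : LWord) : ℕ := sInf (dom w)

/-- A variable ω-located word over `Σ` dominated by `k`. -/
def IsVarWord (k : ℕ → ℕ) (w : LWord) : Prop :=
  (dom w).Finite ∧ (dom w).Nonempty ∧ (∀ n a, w n = some a → a ≤ k n) ∧ ∃ n, w n = some 0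

/-- A (constant) ω-located word over `Σ` dominated by `k`. -/
def IsConstWord (k : ℕ → ℕ) (w : LWord) : Prop :=
  (dom w).Finite ∧ (dom w).Nonempty ∧ ∀ n a, w n = some a → 1 ≤ a ∧ a ≤ k n

/-- `w < u` iff `max dom(w) < min dom(u)`. -/
def wlt (w u : LWord) : Prop := ∀ m n, w m ≠ none → u n ≠ none → m < n

/-- Concatenation `w ⋆ u` of located words (union of graphs, `w` taking precedence). -/
def star (w u : LWord) : LWord := fun n => (w n).orElse (fun _ => u n)

/-- The empty located word. -/
def emptyW : LWord := fun _ => none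

/-- The substitution `T_p`: for `p ≥ 1` it replaces the variable `υ` at position `n`
by `α_p` if `k n ≥ p` and by `α_{k n}` otherwise; `T_0` is the identity. -/
def Tp (k : ℕ → ℕ) (p : ℕ) (w : LWord) : LWord := fun n =>
  match w n with
  | none => none
  | some a => if a = 0 ∧ p ≠ 0 then some (min p (k n)) else some a

/-- The combination `T_{p 0}(w (n 0)) ⋆ ⋯ ⋆ T_{p l}(w (n l))`. -/
def comb (k : ℕ → ℕ) (w : ℕ → LWord) {l : ℕ} (n p : Fin (l + 1) → ℕ) : LWord :=
  (List.ofFn fun i => Tp k (p i) (w (n i))).foldr star emptyW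

/-- `EV(w⃗)`: the extracted variable ω-located words of a sequence `w⃗`. -/
def EV (k : ℕ → ℕ) (w : ℕ → LWord) : Set LWord :=
  {u | ∃ (l : ℕ) (n p : Fin (l + 1) → ℕ), StrictMono n ∧
    (∀ i, p i ≤ k (n i)) ∧ (∃ i, p i = 0) ∧ u = comb k w n p}

/-- `E(w⃗)`: the extracted (constant) ω-located words of a sequence `w⃗`. -/
def Econst (k : ℕ → ℕ) (w : ℕ → LWord) : Set LWord :=
  {u | ∃ (l : ℕ) (n p : Fin (l + 1) → ℕ), StrictMono n ∧
    (∀ i, 1 ≤ p i ∧ p i ≤ k (n i)) ∧ u = comb k w n p}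

/-- An infinite orderly sequence of variable ω-located words, i.e. a member of
`L^∞(Σ,k⃗;υ)`. -/
def OrderlyVar (k : ℕ → ℕ) (w : ℕ → LWord) : Prop :=
  (∀ n, IsVarWord k (w n)) ∧ ∀ n, wlt (w n) (w (n + 1))

/-- `u⃗ ≺ w⃗`: `u⃗` is an extraction of `w⃗`. -/
def Extraction (k : ℕ → ℕ) (u w : ℕ → LWord) : Prop :=
  OrderlyVar k u ∧ ∀ n, u n ∈ EV k w

/-- A finite orderly sequence of variable ω-located words, i.e. a member of
`L^{<∞}(Σ,k⃗;υ)` (the empty list is allowed). -/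
def FinOrderlyV (k : ℕ → ℕ) (ws : List LWord) : Prop :=
  (∀ w ∈ ws, IsVarWord k w) ∧ ws.Chain' wlt

/-- A finite orderly sequence of (constant) ω-located words, i.e. a member of
`L^{<∞}(Σ,k⃗)` (the empty list is allowed). -/
def FinOrderlyC (k : ℕ → ℕ) (ws : List LWord) : Prop :=
  (∀ w ∈ ws, IsConstWord k w) ∧ ws.Chain' wlt

end Farmaki

namespace Farmaki

/-- `u⃗ − t`: the subsequence `(uₙ)_{n ≥ l}` of `u⃗`, where `l = min{n : t < uₙ}`,
re-indexed to start at `0`. -/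
noncomputable def seqMinus (u : ℕ → LWord) (t : LWord) : ℕ → LWord :=
  fun n => u (n + sInf {m | wlt t (u m)})

/-- The combination of the words `w n` along a list of pairs `(n, p)`. -/
def listComb (k : ℕ → ℕ) (w : ℕ → LWord) (L : List (ℕ × ℕ)) : LWord :=
  (L.map fun x => Tp k x.2 (w x.1)).foldr star emptyW

/-- The index-substitution pairs that may occur in an extracted variable word. -/
def IsCode (k : ℕ → ℕ) (L : List (ℕ × ℕ)) : Prop :=
  L.Pairwise (fun x y => x.1 < y.1) ∧ (∀ x ∈ L, x.2 ≤ k x.1) ∧ ∃ x ∈ L, x.2 = 0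

theorem mem_EV_iff {k : ℕ → ℕ} {w : ℕ → LWord} {t : LWord} :
    t ∈ EV k w ↔ ∃ L, IsCode k L ∧ t = listComb k w L := by
  constructor
  · rintro ⟨l, n, p, hn, hp, ⟨i, h0⟩, rfl⟩
    refine ⟨List.ofFn fun i => (n i, p i), ⟨?_, ?_, ?_⟩, ?_⟩
    · rw [List.pairwise_ofFn]
      exact fun i j hij => hn hij
    · intro x hx
      obtain ⟨j, rfl⟩ := List.mem_ofFn.1 hx
      exact hp j
    · exact ⟨_, List.mem_ofFn.2 ⟨i, rfl⟩, h0⟩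
    · simp only [comb, listComb, List.map_ofFn]
      rfl
  · rintro ⟨L, ⟨hs, hp, x, hx, h0⟩, rfl⟩
    obtain ⟨l, hl⟩ : ∃ l, L.length = l + 1 :=
      ⟨L.length - 1, by have := List.length_pos_of_mem hx; omega⟩
    obtain ⟨f, rfl⟩ : ∃ f : Fin (l + 1) → ℕ × ℕ, L = List.ofFn f := by
      refine ⟨fun i => L.get (i.cast hl.symm), ?_⟩
      refine List.ext_getElem (hl.trans List.length_ofFn.symm) fun i _ _ => ?_
      rw [List.getElem_ofFn]
      rfl
    rw [List.pairwise_ofFn] at hs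
    obtain ⟨i, rfl⟩ := List.mem_ofFn.1 hx
    refine ⟨l, fun i => (f i).1, fun i => (f i).2, fun i j hij => hs hij,
      fun j => hp _ (List.mem_ofFn.2 ⟨j, rfl⟩), ⟨i, h0⟩, ?_⟩
    simp only [comb, listComb, List.map_ofFn]
    rfl

theorem star_emptyW (a : LWord) : star a emptyW = a := by
  funext x
  simp only [star, emptyW]
  cases a x <;> rfl

theorem star_assoc (a b c : LWord) : star (star a b) c = star a (star b c) := by
  funext x
  simp only [star]
  cases a x <;> rfl

theorem star_ne_none {a b : LWord} {x : ℕ} :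
    star a b x ≠ none ↔ a x ≠ none ∨ b x ≠ none := by
  simp only [star]
  cases a x <;> simp

theorem Tp_zero (k : ℕ → ℕ) (w : LWord) : Tp k 0 w = w := by
  funext x
  simp only [Tp]
  cases w x <;> simp

theorem Tp_ne_none {k : ℕ → ℕ} {p : ℕ} {w : LWord} {x : ℕ} :
    Tp k p w x ≠ none ↔ w x ≠ none := by
  simp only [Tp]
  cases w x with
  | none => simp
  | some a => by_cases h : a = 0 ∧ p ≠ 0 <;> simp [h]

theorem Tp_star (k : ℕ → ℕ) (p : ℕ) (a b : LWord) :
    Tp k p (star a b) = star (Tp k p a) (Tp k p b) := by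
  funext x
  simp only [Tp, star]
  cases a x with
  | none => simp
  | some c => by_cases h : c = 0 ∧ p ≠ 0 <;> simp [h]

theorem Tp_Tp {k : ℕ → ℕ} (hk : ∀ n, 0 < k n) (p q : ℕ) (w : LWord) :
    Tp k q (Tp k p w) = Tp k (if p = 0 then q else p) w := by
  by_cases hp : p = 0
  · subst hp
    simp [Tp_zero]
  · funext x
    have := hk x
    simp only [Tp, if_neg hp]
    cases w x with
    | none => rfl
    | some a =>
      by_cases ha : a = 0
      · have h0 : min p (k x) ≠ 0 := by omega
        simp [ha, hp, h0]
      · simp [ha]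

section listComb

variable {k : ℕ → ℕ} {w : ℕ → LWord}

theorem listComb_cons (x : ℕ × ℕ) (L : List (ℕ × ℕ)) :
    listComb k w (x :: L) = star (Tp k x.2 (w x.1)) (listComb k w L) := rfl

theorem listComb_append (L M : List (ℕ × ℕ)) :
    listComb k w (L ++ M) = star (listComb k w L) (listComb k w M) := by
  induction L with
  | nil => rfl
  | cons x L ih => rw [List.cons_append, listComb_cons, listComb_cons, ih, star_assoc]

theorem listComb_singleton (x : ℕ × ℕ) : listComb k w [x] = Tp k x.2 (w x.1) :=
  star_emptyW _

theorem Tp_listComb (hk : ∀ n, 0 < k n) (q : ℕ) (L : List (ℕ × ℕ)) :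
    Tp k q (listComb k w L) =
      listComb k w (L.map fun y => (y.1, if y.2 = 0 then q else y.2)) := by
  induction L with
  | nil => rfl
  | cons x L ih => rw [listComb_cons, Tp_star, ih, Tp_Tp hk, List.map_cons, listComb_cons]

theorem listComb_ne_none {L : List (ℕ × ℕ)} {x : ℕ} :
    listComb k w L x ≠ none ↔ ∃ y ∈ L, w y.1 x ≠ none := by
  induction L with
  | nil => simp [listComb, emptyW]
  | cons y L ih => rw [listComb_cons, star_ne_none, ih, Tp_ne_none, List.exists_mem_cons_iff]

theorem exists_of_listComb_eq_some {L : List (ℕ × ℕ)} {x a : ℕ}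
    (h : listComb k w L x = some a) : ∃ y ∈ L, Tp k y.2 (w y.1) x = some a := by
  induction L with
  | nil => simp [listComb, emptyW] at h
  | cons y L ih =>
    rw [listComb_cons, star] at h
    cases hc : Tp k y.2 (w y.1) x with
    | none =>
      rw [hc] at h
      obtain ⟨z, hz, h'⟩ := ih h
      exact ⟨z, List.mem_cons_of_mem _ hz, h'⟩
    | some b =>
      rw [hc] at h
      exact ⟨y, List.mem_cons_self, hc.trans h⟩

end listComb

section Orderly

variable {k : ℕ → ℕ} {u v w : ℕ → LWord}

theorem IsVarWord.exists_ne_none {a : LWord} (h : IsVarWord k a) : ∃ x, a x ≠ none := by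
  obtain ⟨x, hx⟩ := h.2.1
  exact ⟨x, hx⟩

theorem OrderlyVar.wlt_of_lt (hw : OrderlyVar k w) {i j : ℕ} (hij : i < j) :
    wlt (w i) (w j) := by
  induction j, hij using Nat.le_induction with
  | base => exact hw.2 i
  | succ j _ ih =>
    intro x y hx hy
    obtain ⟨z, hz⟩ := (hw.1 j).exists_ne_none
    exact (ih x z hx hz).trans (hw.2 j z y hz hy)

theorem OrderlyVar.eq_of_ne_none (hw : OrderlyVar k w) {i j x : ℕ}
    (hi : w i x ≠ none) (hj : w j x ≠ none) : i = j := by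
  rcases lt_trichotomy i j with h | h | h
  · exact absurd (hw.wlt_of_lt h x x hi hj) (lt_irrefl x)
  · exact h
  · exact absurd (hw.wlt_of_lt h x x hj hi) (lt_irrefl x)

theorem OrderlyVar.shift (hw : OrderlyVar k w) (l : ℕ) :
    OrderlyVar k fun n => w (n + l) :=
  ⟨fun n => hw.1 _, fun _ => hw.wlt_of_lt (by omega)⟩

theorem mem_EV_self (n : ℕ) : w n ∈ EV k w :=
  mem_EV_iff.2 ⟨[(n, 0)], ⟨by simp, by simp, by simp⟩, by
    rw [listComb_singleton, Tp_zero]⟩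

theorem Extraction.shift (hw : OrderlyVar k w) (l : ℕ) :
    Extraction k (fun n => w (n + l)) w :=
  ⟨hw.shift l, fun n => mem_EV_self (n + l)⟩

theorem Extraction.refl (hw : OrderlyVar k w) : Extraction k w w :=
  ⟨hw, mem_EV_self⟩

theorem exists_ne_none_of_mem_EV {t : LWord} (ht : t ∈ EV k w) {x : ℕ} (hx : t x ≠ none) :
    ∃ n, w n x ≠ none := by
  obtain ⟨L, -, rfl⟩ := mem_EV_iff.1 ht
  obtain ⟨y, -, hy⟩ := listComb_ne_none.1 hx
  exact ⟨y.1, hy⟩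

theorem wlt_of_mem_EV {a t : LWord} (ht : t ∈ EV k w) (h : ∀ n, wlt a (w n)) : wlt a t := by
  intro x y hx hy
  obtain ⟨n, hn⟩ := exists_ne_none_of_mem_EV ht hy
  exact h n x y hx hn

theorem isVarWord_of_mem_EV (hw : OrderlyVar k w) {t : LWord}
    (ht : t ∈ EV k w) : IsVarWord k t := by
  obtain ⟨L, ⟨hs, -, z, hz, hz0⟩, rfl⟩ := mem_EV_iff.1 ht
  have hvar : ∃ n, listComb k w L n = some 0 := by
    obtain ⟨x, hx⟩ := (hw.1 z.1).2.2.2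
    have hzx : w z.1 x ≠ none := by simp [hx]
    obtain ⟨b, hb⟩ := Option.ne_none_iff_exists'.1 (listComb_ne_none (k := k).2 ⟨z, hz, hzx⟩)
    obtain ⟨y, hy, hyb⟩ := exists_of_listComb_eq_some hb
    have hyx : w y.1 x ≠ none := Tp_ne_none.1 (by rw [hyb]; simp)
    have hyz : y = z := by
      by_contra hne
      have hs' : L.Pairwise fun x y => x.1 ≠ y.1 := hs.imp ne_of_lt
      have : Std.Symm fun x y : ℕ × ℕ => x.1 ≠ y.1 := ⟨fun _ _ h => h.symm⟩
      exact hs'.forall hy hz hne (hw.eq_of_ne_none hyx hzx)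
    subst hyz
    rw [hz0, Tp_zero, hx] at hyb
    exact ⟨x, hb.trans hyb.symm⟩
  refine ⟨?_, ?_, ?_, hvar⟩
  · refine (Set.Finite.biUnion L.finite_toSet fun y _ => (hw.1 y.1).1).subset ?_
    intro x hx
    obtain ⟨y, hy, h⟩ := listComb_ne_none.1 hx
    exact Set.mem_biUnion hy h
  · obtain ⟨n, hn⟩ := hvar
    exact ⟨n, by simp [dom, hn]⟩
  · intro n a ha
    obtain ⟨y, -, hy⟩ := exists_of_listComb_eq_some ha
    cases hc : w y.1 n with
    | none => simp [Tp, hc] at hy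
    | some b =>
      have hb := (hw.1 y.1).2.2.1 n b hc
      simp only [Tp, hc] at hy
      split_ifs at hy
      · have := Option.some.inj hy
        omega
      · have := Option.some.inj hy
        omega

theorem EV_subset_of_extraction (hk : ∀ n, 0 < k n) (hmono : Monotone k)
    (hw : OrderlyVar k w) (hu : Extraction k u w) : EV k u ⊆ EV k w := by
  choose M hM hMu using fun n => mem_EV_iff.1 (hu.2 n)
  have hlt : ∀ i j, i < j → ∀ a ∈ M i, ∀ b ∈ M j, a.1 < b.1 := by
    intro i j hij a ha b hb
    obtain ⟨x, hx⟩ := (hw.1 a.1).exists_ne_none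
    obtain ⟨y, hy⟩ := (hw.1 b.1).exists_ne_none
    have hux : u i x ≠ none := by
      rw [hMu]
      exact listComb_ne_none.2 ⟨a, ha, hx⟩
    have huy : u j y ≠ none := by
      rw [hMu]
      exact listComb_ne_none.2 ⟨b, hb, hy⟩
    have hxy := hu.1.wlt_of_lt hij x y hux huy
    by_contra hab
    rcases (not_lt.1 hab).lt_or_eq with h | h
    · exact absurd (hw.wlt_of_lt h y x hy hx) hxy.not_gt
    · have hxj : u j x ≠ none := by
        rw [hMu]
        exact listComb_ne_none.2 ⟨b, hb, by rwa [h]⟩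
      exact absurd (hu.1.wlt_of_lt hij x x hux hxj) (lt_irrefl x)
  have hge : ∀ n, ∀ a ∈ M n, n ≤ a.1 := by
    intro n
    induction n with
    | zero => exact fun a _ => Nat.zero_le _
    | succ n ih =>
      intro a ha
      obtain ⟨b, hb, -⟩ := (hM n).2.2
      have h1 := ih b hb
      have h2 := hlt n (n + 1) n.lt_succ_self b hb a ha
      omega
  intro t ht
  obtain ⟨L, ⟨hs, hp, z, hz, hz0⟩, rfl⟩ := mem_EV_iff.1 ht
  refine mem_EV_iff.2 ⟨L.flatMap fun x =>
    (M x.1).map fun y => (y.1, if y.2 = 0 then x.2 else y.2), ⟨?_, ?_, ?_⟩, ?_⟩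
  · rw [List.pairwise_flatMap]
    refine ⟨fun x _ => List.pairwise_map.2 (hM x.1).1, hs.imp fun {x y} hxy => ?_⟩
    intro a ha b hb
    obtain ⟨a', ha', rfl⟩ := List.mem_map.1 ha
    obtain ⟨b', hb', rfl⟩ := List.mem_map.1 hb
    exact hlt _ _ hxy a' ha' b' hb'
  · intro a ha
    obtain ⟨x, hx, ha⟩ := List.mem_flatMap.1 ha
    obtain ⟨y, hy, rfl⟩ := List.mem_map.1 ha
    dsimp only
    split_ifs
    · exact (hp x hx).trans (hmono (hge _ y hy))
    · exact (hM x.1).2.1 y hy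
  · obtain ⟨y, hy, hy0⟩ := (hM z.1).2.2
    exact ⟨_, List.mem_flatMap.2 ⟨z, hz, List.mem_map.2 ⟨y, hy, rfl⟩⟩, by simp [hy0, hz0]⟩
  · clear ht hs hp hz
    induction L with
    | nil => rfl
    | cons x L ih =>
      rw [listComb_cons, ih, List.flatMap_cons, listComb_append, ← Tp_listComb hk, ← hMu]

theorem Extraction.trans (hk : ∀ n, 0 < k n) (hmono : Monotone k) (hw : OrderlyVar k w)
    (hvu : Extraction k v u) (huw : Extraction k u w) : Extraction k v w :=
  ⟨hvu.1, fun n => EV_subset_of_extraction hk hmono hw huw (hvu.2 n)⟩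

end Orderly

/-- A single extraction of `s` serves finitely many words simultaneously. -/
theorem exists_extraction_forall_mem_of_finite {k : ℕ → ℕ} (hk : ∀ n, 0 < k n)
    (hmono : Monotone k) {w : ℕ → LWord} (hw : OrderlyVar k w)
    {R : Set (LWord × (ℕ → LWord))}
    (hi : ∀ (t : LWord) (s : ℕ → LWord), IsVarWord k t → Extraction k s w →
      (∀ n, wlt t (s n)) → ∃ s₁ : ℕ → LWord, Extraction k s₁ s ∧ (t, s₁) ∈ R)
    (hii : ∀ (t : LWord) (s s₁ : ℕ → LWord), (t, s) ∈ R → Extraction k s₁ s → (t, s₁) ∈ R)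
    {A : Set LWord} (hA : A.Finite) {s : ℕ → LWord} (hs : Extraction k s w)
    (hAs : ∀ a ∈ A, ∀ n, wlt a (s n)) :
    ∃ s', Extraction k s' s ∧ ∀ a ∈ A, IsVarWord k a → (a, s') ∈ R := by
  induction A, hA using Set.Finite.induction_on with
  | empty => exact ⟨s, .refl hs.1, by simp⟩
  | @insert a A _ _ ih =>
    obtain ⟨s₁, hs₁, hR⟩ := ih fun b hb => hAs b (Set.mem_insert_of_mem _ hb)
    by_cases ha : IsVarWord k a
    · obtain ⟨s₂, hs₂, hR₂⟩ := hi a s₁ ha (hs₁.trans hk hmono hw hs)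
        fun n => wlt_of_mem_EV (hs₁.2 n) (hAs a (Set.mem_insert _ _))
      refine ⟨s₂, hs₂.trans hk hmono hs.1 hs₁, ?_⟩
      rintro b (rfl | hb) hv
      · exact hR₂
      · exact hii b s₁ s₂ (hR b hb hv) hs₂
    · refine ⟨s₁, hs₁, ?_⟩
      rintro b (rfl | hb) hv
      · exact absurd hv ha
      · exact hR b hb hv

/-- **Lemma 2.8** (diagonal argument). If `R ⊆ Π` satisfies conditions (i) and (ii),
then there is an extraction `u⃗ ≺ w⃗` with `(t, s⃗) ∈ R` for every `t ∈ EV(u⃗)` and every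
`s⃗ ≺ u⃗ − t`. -/
theorem diagonal_lemma
    (k : ℕ → ℕ) (hk : ∀ n, 0 < k n) (hmono : Monotone k)
    (w : ℕ → LWord) (hw : OrderlyVar k w)
    (R : Set (LWord × (ℕ → LWord)))
    (hRsub : ∀ q ∈ R, IsVarWord k q.1 ∧ Extraction k q.2 w ∧ ∀ n, wlt q.1 (q.2 n))
    (hi : ∀ (t : LWord) (s : ℕ → LWord), IsVarWord k t → Extraction k s w →
      (∀ n, wlt t (s n)) → ∃ s₁ : ℕ → LWord, Extraction k s₁ s ∧ (t, s₁) ∈ R)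
    (hii : ∀ (t : LWord) (s s₁ : ℕ → LWord), (t, s) ∈ R → Extraction k s₁ s → (t, s₁) ∈ R) :
    ∃ u : ℕ → LWord, Extraction k u w ∧
      ∀ t ∈ EV k u, ∀ s : ℕ → LWord, Extraction k s (seqMinus u t) → (t, s) ∈ R := by
  let S := {x : (ℕ → LWord) × Set LWord // x.2.Finite ∧ Extraction k x.1 w ∧
    (∀ a ∈ x.2, ∀ n, wlt a (x.1 n)) ∧ ∀ a ∈ x.2, IsVarWord k a → (a, x.1) ∈ R}
  have step : ∀ (N : ℕ) (x : S), ∃ y : S, Extraction k y.1.1 (fun n => x.1.1 (n + 1)) ∧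
      x.1.2 ⊆ y.1.2 ∧ ∀ a ∈ x.1.2, ∀ p ≤ N, star a (Tp k p (x.1.1 0)) ∈ y.1.2 := by
    rintro N ⟨⟨s, A⟩, hA, hs, hAs, -⟩
    let B := A ∪ Set.image2 (fun a p => star a (Tp k p (s 0))) A (Set.Iic N)
    have hB : B.Finite := hA.union (hA.image2 _ (Set.finite_Iic N))
    have htail : Extraction k (fun n => s (n + 1)) s := .shift hs.1 1
    have hBs : ∀ b ∈ B, ∀ n, wlt b (s (n + 1)) := by
      rintro b (hb | ⟨a, ha, p, -, rfl⟩) n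
      · exact hAs b hb (n + 1)
      · intro x y hx hy
        rcases star_ne_none.1 hx with h | h
        · exact hAs a ha (n + 1) x y h hy
        · exact hs.1.wlt_of_lt n.succ_pos x y (Tp_ne_none.1 h) hy
    obtain ⟨s', hs', hR⟩ := exists_extraction_forall_mem_of_finite hk hmono hw hi hii hB
      (htail.trans hk hmono hw hs) hBs
    refine ⟨⟨⟨s', B⟩, hB, (hs'.trans hk hmono hs.1 htail).trans hk hmono hw hs,
      fun b hb n => wlt_of_mem_EV (hs'.2 n) (hBs b hb), hR⟩, hs', Set.subset_union_left, ?_⟩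
    exact fun a ha p hp => Or.inr ⟨a, ha, p, hp, rfl⟩
  choose next hnext hsub hstar using step
  have hempty : ¬ IsVarWord k emptyW := fun h => by simpa [emptyW] using h.exists_ne_none
  let x₀ : S := ⟨⟨w, {emptyW}⟩, Set.finite_singleton _, .refl hw,
    by rintro a rfl n x y hx; exact absurd rfl hx,
    by rintro a rfl h; exact absurd h hempty⟩
  let X : ℕ → S := fun n => Nat.rec x₀ (fun n x => next (k n) x) n
  have hord : ∀ n, OrderlyVar k (X n).1.1 := fun n => (X n).2.2.1.1
  have hXle : ∀ m n, m ≤ n → Extraction k (X n).1.1 (X m).1.1 := by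
    intro m n hmn
    induction n, hmn using Nat.le_induction with
    | base => exact .refl (hord m)
    | succ n _ ih =>
      exact ((hnext (k n) (X n)).trans hk hmono (hord n) (.shift (hord n) 1)).trans
        hk hmono (hord m) ih
  have hAmono : Monotone fun n => (X n).1.2 :=
    monotone_nat_of_le_succ fun n => hsub (k n) (X n)
  let u : ℕ → LWord := fun n => (X n).1.1 0
  have hu : OrderlyVar k u :=
    ⟨fun n => (hord n).1 0, fun n => wlt_of_mem_EV ((hnext (k n) (X n)).2 0)
      fun j => (hord n).wlt_of_lt j.succ_pos⟩
  have hshift : ∀ m l, m ≤ l → Extraction k (fun n => u (n + l)) (X m).1.1 := fun m l hml =>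
    ⟨hu.shift l, fun n => (hXle m (n + l) (by omega)).2 0⟩
  have hcomb : ∀ L : List (ℕ × ℕ), L.Pairwise (fun x y => x.1 < y.1) →
      (∀ x ∈ L, x.2 ≤ k x.1) → ∀ n, (∀ x ∈ L, x.1 < n) → listComb k u L ∈ (X n).1.2 := by
    intro L
    induction L using List.reverseRecOn with
    | nil =>
      intro _ _ n _
      exact hAmono n.zero_le (Set.mem_singleton emptyW)
    | append_singleton L x ih =>
      intro hs hp n hn
      rw [List.pairwise_append] at hs
      have hL := ih hs.1 (fun y hy => hp y (by simp [hy])) x.1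
        fun y hy => hs.2.2 y hy x (by simp)
      rw [listComb_append, listComb_singleton]
      exact hAmono (hn x (by simp)) (hstar (k x.1) (X x.1) _ hL x.2 (hp x (by simp)))
  refine ⟨u, hshift 0 0 le_rfl, fun t ht s hs => ?_⟩
  have hvar := isVarWord_of_mem_EV hu ht
  obtain ⟨L, ⟨hL, hp, z, hz, -⟩, rfl⟩ := mem_EV_iff.1 ht
  obtain ⟨L', x, rfl⟩ := (List.eq_nil_or_concat' L).resolve_left (List.ne_nil_of_mem hz)
  have hmem : listComb k u (L' ++ [x]) ∈ (X (x.1 + 1)).1.2 := by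
    refine hcomb _ hL hp (x.1 + 1) fun y hy => ?_
    rcases List.mem_append.1 hy with h | h
    · exact ((List.pairwise_append.1 hL).2.2 y h x (by simp)).trans (Nat.lt_succ_self _)
    · rw [List.mem_singleton.1 h]
      exact Nat.lt_succ_self _
  have hle : x.1 + 1 ≤ sInf {m | wlt (listComb k u (L' ++ [x])) (u m)} := by
    refine le_csInf ⟨x.1 + 1, (X (x.1 + 1)).2.2.2.1 _ hmem 0⟩ fun j hj => ?_
    by_contra hlt
    obtain ⟨a, ha⟩ := (hu.1 x.1).exists_ne_none
    have hta : listComb k u (L' ++ [x]) a ≠ none := listComb_ne_none.2 ⟨x, by simp, ha⟩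
    rcases (show j ≤ x.1 by omega).lt_or_eq with h | rfl
    · obtain ⟨b, hb⟩ := (hu.1 j).exists_ne_none
      exact absurd (hu.wlt_of_lt h b a hb ha) (hj a b hta hb).not_gt
    · exact absurd (hj a a hta ha) (lt_irrefl a)
  exact hii _ _ _ ((X (x.1 + 1)).2.2.2.2 _ hmem hvar)
    (hs.trans hk hmono (hord (x.1 + 1)) (hshift (x.1 + 1) _ hle))

end Farmaki
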